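/- arXiv:1910.05678 — 2 statements merged into one kernel-verified Lean document; each statement's English description precedes it below -/
import Mathlib

section
/- Let f : ℝ² → ℝ be continuous and let u : ℝ² → ℝ be three times continuously differentiable with Δu = −f on ℝ². Let C : [0,1] × ℝ → ℝ², C(q,t) = (x(q,t), y(q,t)), be a twice continuously differentiable family of closed curves, i.e., C(0,t) = C(1,t) and ∂_q C(0,t) = ∂_q C(1,t) for every t. Define F(t) = ∫_0^1 ( ∂u/∂y(C(q,t)) · x_q(q,t) − ∂u/∂x(C(q,t)) · y_q(q,t) ) dq, where subscripts denote partial derivatives. Then F is differentiable in t and F′(t) = ∫_0^1 f(C(q,t)) · ( y_q(q,t) x_t(q,t) − x_q(q,t) y_t(q,t) ) dq. Equivalently, writing N = (−y_q, x_q)/‖C_q‖ for the unit normal and ds = ‖C_q‖ dq for arclength, F′(t) = −∫_0^1 C_t · f(C) N ds. -/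
open MeasureTheory

section ParametricLineIntegral

variable {E F : Type*} [NormedAddCommGroup E] [NormedSpace ℝ E]
  [NormedAddCommGroup F] [NormedSpace ℝ F]

/-- Derivative of a function on the plane along its first coordinate line. -/
theorem HasFDerivAt.hasDerivAt_fst_line {g : ℝ × ℝ → F} {g' : ℝ × ℝ →L[ℝ] F} {q t : ℝ}
    (hg : HasFDerivAt g g' (q, t)) : HasDerivAt (fun σ => g (σ, t)) (g' (1, 0)) q :=
  hg.comp_hasDerivAt q ((hasDerivAt_id q).prodMk (hasDerivAt_const q t))

/-- Derivative of a function on the plane along its second coordinate line. -/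
theorem HasFDerivAt.hasDerivAt_snd_line {g : ℝ × ℝ → F} {g' : ℝ × ℝ →L[ℝ] F} {q t : ℝ}
    (hg : HasFDerivAt g g' (q, t)) : HasDerivAt (fun τ => g (q, τ)) (g' (0, 1)) t :=
  hg.comp_hasDerivAt t ((hasDerivAt_const t q).prodMk (hasDerivAt_id t))

/-- Leibniz rule for the integral of a `C¹` function over a fixed compact interval. -/
theorem ContDiff.hasDerivAt_intervalIntegral_snd {g : ℝ × ℝ → F} (hg : ContDiff ℝ 1 g)
    (a b t : ℝ) :
    HasDerivAt (fun τ => ∫ q in a..b, g (q, τ)) (∫ q in a..b, fderiv ℝ g (q, t) (0, 1)) t := by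
  have hcont : Continuous fun p => fderiv ℝ g p (0, 1) :=
    (hg.continuous_fderiv one_ne_zero).clm_apply continuous_const
  obtain ⟨M, hM⟩ := (isCompact_uIcc.prod (isCompact_closedBall t 1)).exists_bound_of_continuousOn
    (s := Set.uIcc a b ×ˢ Metric.closedBall t 1) hcont.continuousOn
  refine (intervalIntegral.hasDerivAt_integral_of_dominated_loc_of_deriv_le (μ := volume)
    (F := fun τ q => g (q, τ)) (F' := fun τ q => fderiv ℝ g (q, τ) (0, 1)) (bound := fun _ => M)
    (Metric.closedBall_mem_nhds t one_pos)
    (.of_forall fun τ => ?_) ?_ ?_ ?_ intervalIntegrable_const ?_).2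
  · exact (hg.continuous.comp (by fun_prop : Continuous fun q : ℝ => (q, τ))).aestronglyMeasurable
  · exact (hg.continuous.comp
      (by fun_prop : Continuous fun q : ℝ => (q, t))).intervalIntegrable _ _
  · exact (hcont.comp (by fun_prop : Continuous fun q : ℝ => (q, t))).aestronglyMeasurable
  · exact .of_forall fun q hq τ hτ => hM (q, τ) ⟨Set.uIoc_subset_uIcc hq, hτ⟩
  · exact .of_forall fun q _ τ _ =>
      ((hg.differentiable one_ne_zero) (q, τ)).hasFDerivAt.hasDerivAt_snd_line

/-- First variation of the line integral of a `C¹` one-form `W` along a `C²` family of closed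
curves: it is the integral of the exterior derivative of `W`. -/
theorem hasDerivAt_lineIntegral_of_closed {W : E → E →L[ℝ] ℝ} (hW : ContDiff ℝ 1 W)
    {C : ℝ × ℝ → E} (hC : ContDiff ℝ 2 C) {a b : ℝ} (hclosed : ∀ t, C (a, t) = C (b, t)) (t : ℝ) :
    HasDerivAt (fun τ => ∫ q in a..b, W (C (q, τ)) (fderiv ℝ C (q, τ) (1, 0)))
      (∫ q in a..b,
        (fderiv ℝ W (C (q, t)) (fderiv ℝ C (q, t) (0, 1)) (fderiv ℝ C (q, t) (1, 0))
          - fderiv ℝ W (C (q, t)) (fderiv ℝ C (q, t) (1, 0)) (fderiv ℝ C (q, t) (0, 1)))) t := by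
  have hC' : ContDiff ℝ 1 (fderiv ℝ C) := hC.fderiv_right (by norm_num)
  have hWC : ContDiff ℝ 1 fun p => W (C p) := hW.comp (hC.of_le (by norm_num))
  have hpair (v : ℝ × ℝ) : ContDiff ℝ 1 fun p => W (C p) (fderiv ℝ C p v) :=
    hWC.clm_apply (hC'.clm_apply contDiff_const)
  have hCd (p) : HasFDerivAt C (fderiv ℝ C p) p :=
    (hC.differentiable two_ne_zero p).hasFDerivAt
  have hderiv (v w p : ℝ × ℝ) : fderiv ℝ (fun p => W (C p) (fderiv ℝ C p v)) p w
      = W (C p) (fderiv ℝ (fderiv ℝ C) p w v)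
        + fderiv ℝ W (C p) (fderiv ℝ C p w) (fderiv ℝ C p v) := by
    have h₁ : HasFDerivAt (fun p => W (C p)) _ p :=
      (hW.differentiable one_ne_zero (C p)).hasFDerivAt.comp p (hCd p)
    have h₂ := ((hC'.differentiable one_ne_zero p).hasFDerivAt.clm_apply
      (hasFDerivAt_const v p))
    rw [(h₁.clm_apply h₂).fderiv]
    simp
  have hcont (v w : ℝ × ℝ) :
      Continuous fun q : ℝ => fderiv ℝ (fun p => W (C p) (fderiv ℝ C p v)) (q, t) w :=
    (((hpair v).continuous_fderiv one_ne_zero).clm_apply continuous_const).comp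
      (by fun_prop : Continuous fun q : ℝ => (q, t))
  have hend : fderiv ℝ C (a, t) (0, 1) = fderiv ℝ C (b, t) (0, 1) := by
    have h := (hCd (a, t)).hasDerivAt_snd_line
    simp only [hclosed] at h
    exact h.unique (hCd (b, t)).hasDerivAt_snd_line
  have hexact : ∫ q in a..b,
      fderiv ℝ (fun p => W (C p) (fderiv ℝ C p (0, 1))) (q, t) (1, 0) = 0 := by
    rw [intervalIntegral.integral_eq_sub_of_hasDerivAt
      (fun q _ => ((hpair (0, 1)).differentiable one_ne_zero
        (q, t)).hasFDerivAt.hasDerivAt_fst_line) ((hcont _ _).intervalIntegrable _ _),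
      hclosed, hend, sub_self]
  refine ((hpair (1, 0)).hasDerivAt_intervalIntegral_snd a b t).congr_deriv ?_
  refine (sub_zero _).symm.trans ((congrArg _ hexact.symm).trans ?_)
  rw [← intervalIntegral.integral_sub ((hcont _ _).intervalIntegrable _ _)
    ((hcont _ _).intervalIntegrable _ _)]
  refine intervalIntegral.integral_congr fun q _ => ?_
  have hsymm : fderiv ℝ (fderiv ℝ C) (q, t) (0, 1) (1, 0)
      = fderiv ℝ (fderiv ℝ C) (q, t) (1, 0) (0, 1) :=
    hC.contDiffAt.isSymmSndFDerivAt (by simp) _ _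
  simp only [hderiv, hsymm]
  ring

end ParametricLineIntegral

/-- **Theorem 1.** Let `Δu = -f` on `ℝ²` with `u` of class `C³` and `f` continuous, and let
`C(q,t) = (x(q,t), y(q,t))` be a `C²` family of closed curves. Then the Green's-theorem line
integral `F(t) = ∫_0^1 (u_y(C) x_q - u_x(C) y_q) dq` is differentiable with
`F'(t) = ∫_0^1 f(C) (y_q x_t - x_q y_t) dq`, i.e. `F'(t) = -∫ C_t ⋅ f(C) N ds`. -/
theorem gateaux_derivative_region_functional
    (f u : ℝ × ℝ → ℝ) (hf : Continuous f) (hu : ContDiff ℝ 3 u)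
    (hlap : ∀ p : ℝ × ℝ,
      fderiv ℝ (fun x => fderiv ℝ u x (1, 0)) p (1, 0)
        + fderiv ℝ (fun x => fderiv ℝ u x (0, 1)) p (0, 1) = -f p)
    (C : ℝ × ℝ → ℝ × ℝ) (hC : ContDiff ℝ 2 C)
    (hclosed : ∀ t : ℝ, C (0, t) = C (1, t))
    (hclosed' : ∀ t : ℝ, fderiv ℝ C (0, t) (1, 0) = fderiv ℝ C (1, t) (1, 0)) :
    ∀ t : ℝ, HasDerivAt
      (fun τ => ∫ q in (0:ℝ)..1,
        (fderiv ℝ u (C (q, τ)) (0, 1) * (fderiv ℝ C (q, τ) (1, 0)).1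
          - fderiv ℝ u (C (q, τ)) (1, 0) * (fderiv ℝ C (q, τ) (1, 0)).2))
      (∫ q in (0:ℝ)..1, f (C (q, t)) *
        ((fderiv ℝ C (q, t) (1, 0)).2 * (fderiv ℝ C (q, t) (0, 1)).1
          - (fderiv ℝ C (q, t) (1, 0)).1 * (fderiv ℝ C (q, t) (0, 1)).2)) t := by
  intro t
  have hu' : ContDiff ℝ 1 (fderiv ℝ u) := hu.fderiv_right (by norm_num)
  have hP (v : ℝ × ℝ) : ContDiff ℝ 1 fun p => fderiv ℝ u p v := hu'.clm_apply contDiff_const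
  have hPd (v p : ℝ × ℝ) := ((hP v).differentiable one_ne_zero p).hasFDerivAt
  let W : ℝ × ℝ → ℝ × ℝ →L[ℝ] ℝ := fun p =>
    fderiv ℝ u p (0, 1) • ContinuousLinearMap.fst ℝ ℝ ℝ
      - fderiv ℝ u p (1, 0) • ContinuousLinearMap.snd ℝ ℝ ℝ
  have hW : ContDiff ℝ 1 W :=
    ((hP (0, 1)).smul contDiff_const).sub ((hP (1, 0)).smul contDiff_const)
  have hexp (L : ℝ × ℝ →L[ℝ] ℝ) (v : ℝ × ℝ) : L v = v.1 * L (1, 0) + v.2 * L (0, 1) := by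
    conv_lhs => rw [show v = v.1 • ((1, 0) : ℝ × ℝ) + v.2 • ((0, 1) : ℝ × ℝ) by ext <;> simp]
    simp only [map_add, map_smul, smul_eq_mul]
  have hdW (p v w : ℝ × ℝ) : fderiv ℝ W p v w - fderiv ℝ W p w v
      = f p * (w.2 * v.1 - w.1 * v.2) := by
    have h : HasFDerivAt W _ p :=
      ((hPd (0, 1) p).smul_const (ContinuousLinearMap.fst ℝ ℝ ℝ)).sub
        ((hPd (1, 0) p).smul_const (ContinuousLinearMap.snd ℝ ℝ ℝ))
    rw [h.fderiv]
    simp only [sub_apply, ContinuousLinearMap.smulRight_apply, smul_apply,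
      ContinuousLinearMap.coe_fst', ContinuousLinearMap.coe_snd', smul_eq_mul]
    rw [hexp _ v, hexp _ w, hexp (fderiv ℝ (fun x => fderiv ℝ u x (1, 0)) p) v,
      hexp (fderiv ℝ (fun x => fderiv ℝ u x (1, 0)) p) w]
    linear_combination (w.1 * v.2 - w.2 * v.1) * hlap p
  have hmain := hasDerivAt_lineIntegral_of_closed hW hC hclosed t
  simp only [hdW] at hmain
  exact hmain
end

section
/- Let u : ℝ² → ℝ be three times continuously differentiable and let C : [0,1] × ℝ → ℝ², C(q,t) = (x(q,t), y(q,t)), be a twice continuously differentiable family of closed curves, i.e., C(0,t) = C(1,t) and ∂_q C(0,t) = ∂_q C(1,t) for every t. Then d/dt ∫_0^1 ( ∂u/∂y(C(q,t)) · x_q(q,t) − ∂u/∂x(C(q,t)) · y_q(q,t) ) dq = ∫_0^1 Δu(C(q,t)) · ( x_q(q,t) y_t(q,t) − y_q(q,t) x_t(q,t) ) dq, where Δu = ∂²u/∂x² + ∂²u/∂y² and subscripts denote partial derivatives. -/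
open MeasureTheory

/-- Differentiation under the integral sign for a `C¹` integrand on a compact interval. -/
theorem hasDerivAt_intervalIntegral_of_contDiff {F : ℝ × ℝ → ℝ} (hF : ContDiff ℝ 1 F)
    (a b t : ℝ) :
    HasDerivAt (fun τ => ∫ q in a..b, F (q, τ))
      (∫ q in a..b, fderiv ℝ F (q, t) (0, 1)) t := by
  have hFt : Continuous fun p : ℝ × ℝ => fderiv ℝ F p (0, 1) :=
    (hF.continuous_fderiv one_ne_zero).clm_apply continuous_const
  obtain ⟨M, hM⟩ := (isCompact_uIcc.prod (isCompact_closedBall t 1)).exists_bound_of_continuousOn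
    (s := Set.uIcc a b ×ˢ Metric.closedBall t 1) hFt.continuousOn
  refine (intervalIntegral.hasDerivAt_integral_of_dominated_loc_of_deriv_le
    (F := fun τ q => F (q, τ)) (F' := fun τ q => fderiv ℝ F (q, τ) (0, 1))
    (bound := fun _ => M) (Metric.closedBall_mem_nhds t one_pos) ?_ ?_ ?_ ?_ ?_ ?_).2
  · exact .of_forall fun τ =>
      (hF.continuous.comp (Continuous.prodMk_left τ)).aestronglyMeasurable
  · exact (hF.continuous.comp (Continuous.prodMk_left t)).intervalIntegrable _ _
  · exact (hFt.comp (Continuous.prodMk_left t)).aestronglyMeasurable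
  · exact .of_forall fun q hq τ hτ => hM (q, τ) ⟨Set.uIoc_subset_uIcc hq, hτ⟩
  · exact intervalIntegrable_const
  · exact .of_forall fun q _ τ _ =>
      (hF.differentiable one_ne_zero (q, τ)).hasFDerivAt.comp_hasDerivAt τ
        ((hasDerivAt_const τ q).prodMk (hasDerivAt_id τ))

/-- The integral of the derivative along the first variable is the difference of the end values. -/
theorem integral_fderiv_fst_eq_sub {G : ℝ × ℝ → ℝ} (hG : ContDiff ℝ 1 G) (a b t : ℝ) :
    ∫ q in a..b, fderiv ℝ G (q, t) (1, 0) = G (b, t) - G (a, t) := by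
  have hGq : Continuous fun p : ℝ × ℝ => fderiv ℝ G p (1, 0) :=
    (hG.continuous_fderiv one_ne_zero).clm_apply continuous_const
  refine intervalIntegral.integral_eq_sub_of_hasDerivAt (f := fun q => G (q, t)) (fun q _ => ?_)
    ((hGq.comp (Continuous.prodMk_left t)).intervalIntegrable _ _)
  exact (hG.differentiable one_ne_zero (q, t)).hasFDerivAt.comp_hasDerivAt q
    ((hasDerivAt_id q).prodMk (hasDerivAt_const q t))

/-- A partial derivative of a `C²` function is `C¹`. -/
theorem contDiff_one_fderiv_apply {f : ℝ × ℝ → ℝ} (hf : ContDiff ℝ 2 f) (v : ℝ × ℝ) :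
    ContDiff ℝ 1 fun p => fderiv ℝ f p v :=
  (hf.fderiv_right (by norm_num)).clm_apply contDiff_const

/-- Mixed directional derivatives of a `C²` function commute. -/
theorem fderiv_fderiv_apply_comm {f : ℝ × ℝ → ℝ} (hf : ContDiff ℝ 2 f) (p v w : ℝ × ℝ) :
    fderiv ℝ (fun p => fderiv ℝ f p v) p w = fderiv ℝ (fun p => fderiv ℝ f p w) p v := by
  have hd : DifferentiableAt ℝ (fderiv ℝ f) p :=
    (hf.fderiv_right (m := 1) (by norm_num)).differentiable one_ne_zero p
  rw [fderiv_clm_apply hd (differentiableAt_const _),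
    fderiv_clm_apply hd (differentiableAt_const _)]
  simpa using (hf.contDiffAt.isSymmSndFDerivAt (by simp)).eq w v

/-- Variation of `∫ p df` along a family of curves on whose end points `p ∂ₜf` agrees. -/
theorem hasDerivAt_integral_mul_fderiv {p f : ℝ × ℝ → ℝ} (hp : ContDiff ℝ 1 p)
    (hf : ContDiff ℝ 2 f) {a b t : ℝ}
    (hab : p (a, t) * fderiv ℝ f (a, t) (0, 1) = p (b, t) * fderiv ℝ f (b, t) (0, 1)) :
    HasDerivAt (fun τ => ∫ q in a..b, p (q, τ) * fderiv ℝ f (q, τ) (1, 0))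
      (∫ q in a..b, (fderiv ℝ p (q, t) (0, 1) * fderiv ℝ f (q, t) (1, 0)
        - fderiv ℝ p (q, t) (1, 0) * fderiv ℝ f (q, t) (0, 1))) t := by
  have hfq := contDiff_one_fderiv_apply hf (1, 0)
  have hft := contDiff_one_fderiv_apply hf (0, 1)
  have hF := hp.mul hfq
  have hG := hp.mul hft
  have hintegrable {H : ℝ × ℝ → ℝ} (hH : ContDiff ℝ 1 H) (v : ℝ × ℝ) :
      IntervalIntegrable (fun q => fderiv ℝ H (q, t) v) volume a b :=
    (((hH.continuous_fderiv one_ne_zero).comp (Continuous.prodMk_left t)).clm_apply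
      continuous_const).intervalIntegrable _ _
  have hintegrand (q : ℝ) : fderiv ℝ p (q, t) (0, 1) * fderiv ℝ f (q, t) (1, 0)
        - fderiv ℝ p (q, t) (1, 0) * fderiv ℝ f (q, t) (0, 1) =
      fderiv ℝ (fun z => p z * fderiv ℝ f z (1, 0)) (q, t) (0, 1)
        - fderiv ℝ (fun z => p z * fderiv ℝ f z (0, 1)) (q, t) (1, 0) := by
    have hpd := hp.differentiable one_ne_zero (q, t)
    rw [fderiv_fun_mul hpd (hfq.differentiable one_ne_zero (q, t)),
      fderiv_fun_mul hpd (hft.differentiable one_ne_zero (q, t))]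
    simp only [add_apply, smul_apply, smul_eq_mul]
    rw [fderiv_fderiv_apply_comm hf (q, t) (1, 0) (0, 1)]
    ring
  simp_rw [hintegrand]
  rw [intervalIntegral.integral_sub (hintegrable hF _) (hintegrable hG _),
    integral_fderiv_fst_eq_sub hG, hab, sub_self, sub_zero]
  exact hasDerivAt_intervalIntegral_of_contDiff hF a b t

/-- The chain rule for `g ∘ C` written in coordinates of the plane. -/
theorem fderiv_comp_apply_prod {g : ℝ × ℝ → ℝ} {C : ℝ × ℝ → ℝ × ℝ} {p : ℝ × ℝ}
    (hg : DifferentiableAt ℝ g (C p)) (hC : DifferentiableAt ℝ C p) (v : ℝ × ℝ) :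
    fderiv ℝ (fun p => g (C p)) p v =
      fderiv ℝ g (C p) (1, 0) * (fderiv ℝ C p v).1
        + fderiv ℝ g (C p) (0, 1) * (fderiv ℝ C p v).2 := by
  have hv : fderiv ℝ C p v =
      (fderiv ℝ C p v).1 • ((1, 0) : ℝ × ℝ) + (fderiv ℝ C p v).2 • ((0, 1) : ℝ × ℝ) := by
    ext <;> simp
  rw [show (fun p => g (C p)) = g ∘ C from rfl, fderiv_comp p hg hC,
    ContinuousLinearMap.comp_apply]
  conv_lhs => rw [hv]
  simp only [map_add, map_smul, smul_eq_mul, mul_comm]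

/-- If `C` agrees on two vertical lines, so do its derivatives along them. -/
theorem fderiv_snd_eq_of_forall_eq {C : ℝ × ℝ → ℝ × ℝ} (hC : Differentiable ℝ C) {a b : ℝ}
    (hab : ∀ t, C (a, t) = C (b, t)) (t : ℝ) :
    fderiv ℝ C (a, t) (0, 1) = fderiv ℝ C (b, t) (0, 1) := by
  have hderiv (q : ℝ) : HasDerivAt (fun τ => C (q, τ)) (fderiv ℝ C (q, t) (0, 1)) t :=
    (hC (q, t)).hasFDerivAt.comp_hasDerivAt t ((hasDerivAt_const t q).prodMk (hasDerivAt_id t))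
  have ha := hderiv a
  simp_rw [hab] at ha
  exact ha.unique (hderiv b)

/-- Key identity in the proof of Theorem 1: for a `C³` function `u` and a `C²` family of
closed curves `C(q,t) = (x(q,t), y(q,t))`,
`d/dt ∫_0^1 (u_y(C) x_q - u_x(C) y_q) dq = ∫_0^1 Δu(C) (x_q y_t - y_q x_t) dq`. -/
theorem deriv_line_integral_eq_laplacian_integral
    (u : ℝ × ℝ → ℝ) (hu : ContDiff ℝ 3 u)
    (C : ℝ × ℝ → ℝ × ℝ) (hC : ContDiff ℝ 2 C)
    (hclosed : ∀ t : ℝ, C (0, t) = C (1, t))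
    (hclosed' : ∀ t : ℝ, fderiv ℝ C (0, t) (1, 0) = fderiv ℝ C (1, t) (1, 0)) :
    ∀ t : ℝ, HasDerivAt
      (fun τ => ∫ q in (0:ℝ)..1,
        (fderiv ℝ u (C (q, τ)) (0, 1) * (fderiv ℝ C (q, τ) (1, 0)).1
          - fderiv ℝ u (C (q, τ)) (1, 0) * (fderiv ℝ C (q, τ) (1, 0)).2))
      (∫ q in (0:ℝ)..1,
        (fderiv ℝ (fun x => fderiv ℝ u x (1, 0)) (C (q, t)) (1, 0)
          + fderiv ℝ (fun x => fderiv ℝ u x (0, 1)) (C (q, t)) (0, 1)) *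
        ((fderiv ℝ C (q, t) (1, 0)).1 * (fderiv ℝ C (q, t) (0, 1)).2
          - (fderiv ℝ C (q, t) (1, 0)).2 * (fderiv ℝ C (q, t) (0, 1)).1)) t := by
  intro t
  have hCd : Differentiable ℝ C := hC.differentiable two_ne_zero
  have hx (p v : ℝ × ℝ) : fderiv ℝ (fun z => (C z).1) p v = (fderiv ℝ C p v).1 := by
    rw [(hCd p).hasFDerivAt.fst.fderiv]; rfl
  have hy (p v : ℝ × ℝ) : fderiv ℝ (fun z => (C z).2) p v = (fderiv ℝ C p v).2 := by
    rw [(hCd p).hasFDerivAt.snd.fderiv]; rfl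
  have hgrad (v : ℝ × ℝ) : ContDiff ℝ 1 fun z => fderiv ℝ u z v :=
    contDiff_one_fderiv_apply (hu.of_le (by norm_num)) v
  have hgradC (v : ℝ × ℝ) : ContDiff ℝ 1 fun z => fderiv ℝ u (C z) v :=
    (hgrad v).comp (hC.of_le one_le_two)
  have hCt := fderiv_snd_eq_of_forall_eq hCd hclosed t
  have hxvar := hasDerivAt_integral_mul_fderiv (hgradC (0, 1)) hC.fst (a := 0) (b := 1) (t := t)
    (by rw [hx, hx, hclosed, hCt])
  have hyvar := hasDerivAt_integral_mul_fderiv (hgradC (1, 0)) hC.snd (a := 0) (b := 1) (t := t)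
    (by rw [hy, hy, hclosed, hCt])
  have hslice {H : ℝ × ℝ → ℝ} (hH : Continuous H) (τ : ℝ) :
      IntervalIntegrable (fun q => H (q, τ)) volume 0 1 :=
    (hH.comp (Continuous.prodMk_left τ)).intervalIntegrable _ _
  have hpartial {H : ℝ × ℝ → ℝ} (hH : ContDiff ℝ 1 H) (v : ℝ × ℝ) :
      Continuous fun z => fderiv ℝ H z v :=
    (hH.continuous_fderiv one_ne_zero).clm_apply continuous_const
  have hxpartial := hpartial (hC.fst.of_le one_le_two)
  have hypartial := hpartial (hC.snd.of_le one_le_two)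
  have hvar := hxvar.sub hyvar
  rw [← intervalIntegral.integral_sub] at hvar
  rotate_left
  · exact hslice (((hpartial (hgradC (0, 1)) (0, 1)).mul (hxpartial (1, 0))).sub
      ((hpartial (hgradC (0, 1)) (1, 0)).mul (hxpartial (0, 1)))) t
  · exact hslice (((hpartial (hgradC (1, 0)) (0, 1)).mul (hypartial (1, 0))).sub
      ((hpartial (hgradC (1, 0)) (1, 0)).mul (hypartial (0, 1)))) t
  refine (hvar.congr_deriv ?_).congr_of_eventuallyEq (.of_forall fun τ => ?_)
  · refine intervalIntegral.integral_congr fun q _ => ?_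
    have hchain (v w : ℝ × ℝ) := fderiv_comp_apply_prod
      ((hgrad v).differentiable one_ne_zero (C (q, t))) (hCd (q, t)) w
    simp only [hx, hy, hchain]
    ring
  · rw [Pi.sub_apply, ← intervalIntegral.integral_sub]
    · simp only [hx, hy]
    · exact hslice ((hgradC (0, 1)).continuous.mul (hxpartial (1, 0))) τ
    · exact hslice ((hgradC (1, 0)).continuous.mul (hypartial (1, 0))) τ
end
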